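/- arXiv:2006.15734 — 2 statements merged into one kernel-verified Lean document; each statement's English description precedes it below -/
import Mathlib

section
/- Let m ≥ 5 be an integer. Then there exists a set T of m ordered triples of the form (0, x, z) with 0 < x < z such that the union of the sets {x, z − x, z} over (0, x, z) ∈ T equals {3, 4, ..., 3m+2} if m ≡ 0 or 1 (mod 4), and equals {3, 4, ..., 3m+1} ∪ {3m+3} if m ≡ 2 or 3 (mod 4}. (In particular the 3m values x, z−x, z over all triples are pairwise distinct.) -/
/-- The arithmetic family of triples `(x + 2i, z + i)`, `i < n`. -/
def tripFam (x z n : ℕ) : Finset (ℕ × ℕ) :=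
  (Finset.range n).image (fun i => (x + 2 * i, z + i))

/-- Numbers hit by the differences of `tripFam x z n`. -/
def tripHit (x z n v : ℕ) : Prop :=
  (x ≤ v ∧ v < x + 2 * n ∧ (v - x) % 2 = 0) ∨ (z ≤ v ∧ v < z + n) ∨
    (z < v + x + n ∧ v + x ≤ z)

/-- `v` is one of the differences of `p`. -/
def tripIn (p : ℕ × ℕ) (v : ℕ) : Prop := v = p.1 ∨ v = p.2 - p.1 ∨ v = p.2

lemma tripFam_card (x z n : ℕ) : (tripFam x z n).card ≤ n := by
  simpa [tripFam] using
    Finset.card_image_le (s := Finset.range n) (f := fun i => (x + 2 * i, z + i))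

lemma tripHit_mem {x z n v : ℕ} (h : tripHit x z n v) :
    ∃ p ∈ tripFam x z n, tripIn p v := by
  have mk : ∀ i < n, (x + 2 * i, z + i) ∈ tripFam x z n := fun i hi =>
    Finset.mem_image.2 ⟨i, Finset.mem_range.2 hi, rfl⟩
  rcases h with h | h | h
  · refine ⟨_, mk ((v - x) / 2) (by omega), Or.inl ?_⟩
    show v = x + 2 * ((v - x) / 2)
    omega
  · refine ⟨_, mk (v - z) (by omega), Or.inr (Or.inr ?_)⟩
    show v = z + (v - z)
    omega
  · refine ⟨_, mk (z - x - v) (by omega), Or.inr (Or.inl ?_)⟩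
    show v = z + (z - x - v) - (x + 2 * (z - x - v))
    omega

lemma trip_key (m : ℕ) (T : Finset (ℕ × ℕ)) (S : Finset ℕ) (hT : T.card ≤ m)
    (hpos : ∀ p ∈ T, 0 < p.1 ∧ p.1 < p.2) (hS : S.card = 3 * m)
    (hc : ∀ v ∈ S, ∃ p ∈ T, tripIn p v) :
    ∃ T : Finset (ℕ × ℕ), T.card = m ∧ (∀ p ∈ T, 0 < p.1 ∧ p.1 < p.2) ∧
      T.biUnion (fun p => ({p.1, p.2 - p.1, p.2} : Finset ℕ)) = S ∧
      (T.biUnion (fun p => ({p.1, p.2 - p.1, p.2} : Finset ℕ))).card = 3 * m := by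
  have hsub : S ⊆ T.biUnion (fun p => ({p.1, p.2 - p.1, p.2} : Finset ℕ)) := by
    intro v hv
    obtain ⟨p, hp, h⟩ := hc v hv
    exact Finset.mem_biUnion.2 ⟨p, hp, by simpa [tripIn] using h⟩
  have hle : (T.biUnion (fun p => ({p.1, p.2 - p.1, p.2} : Finset ℕ))).card ≤ T.card * 3 :=
    Finset.card_biUnion_le_card_mul _ _ _ (fun p _ => Finset.card_le_three)
  have h2 := Finset.card_le_card hsub
  have heq := Finset.eq_of_subset_of_card_le hsub (by omega)
  exact ⟨T, by omega, hpos, heq.symm, by rw [← heq, hS]⟩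

lemma trip_families (m : ℕ) (S : Finset ℕ) (hS : S.card = 3 * m)
    (x₁ z₁ n₁ x₂ z₂ n₂ x₃ z₃ n₃ : ℕ) (L : List (ℕ × ℕ))
    (hcard : n₁ + n₂ + n₃ + L.length ≤ m)
    (h₁ : 0 < x₁ ∧ x₁ + n₁ ≤ z₁) (h₂ : 0 < x₂ ∧ x₂ + n₂ ≤ z₂) (h₃ : 0 < x₃ ∧ x₃ + n₃ ≤ z₃)
    (hL : ∀ p ∈ L, 0 < p.1 ∧ p.1 < p.2)
    (hc : ∀ v ∈ S, tripHit x₁ z₁ n₁ v ∨ tripHit x₂ z₂ n₂ v ∨ tripHit x₃ z₃ n₃ v ∨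
      ∃ p ∈ L, tripIn p v) :
    ∃ T : Finset (ℕ × ℕ), T.card = m ∧ (∀ p ∈ T, 0 < p.1 ∧ p.1 < p.2) ∧
      T.biUnion (fun p => ({p.1, p.2 - p.1, p.2} : Finset ℕ)) = S ∧
      (T.biUnion (fun p => ({p.1, p.2 - p.1, p.2} : Finset ℕ))).card = 3 * m := by
  have fpos : ∀ x z n, 0 < x ∧ x + n ≤ z → ∀ p ∈ tripFam x z n, 0 < p.1 ∧ p.1 < p.2 := by
    intro x z n h p hp
    obtain ⟨i, hi, rfl⟩ := Finset.mem_image.1 hp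
    have := Finset.mem_range.1 hi
    constructor <;> dsimp only <;> omega
  refine trip_key m
    (tripFam x₁ z₁ n₁ ∪ (tripFam x₂ z₂ n₂ ∪ (tripFam x₃ z₃ n₃ ∪ L.toFinset))) S ?_ ?_ hS ?_
  · have a := tripFam_card x₁ z₁ n₁
    have b := tripFam_card x₂ z₂ n₂
    have c := tripFam_card x₃ z₃ n₃
    have d := L.toFinset_card_le
    have e := Finset.card_union_le (tripFam x₁ z₁ n₁)
      (tripFam x₂ z₂ n₂ ∪ (tripFam x₃ z₃ n₃ ∪ L.toFinset))
    have f := Finset.card_union_le (tripFam x₂ z₂ n₂) (tripFam x₃ z₃ n₃ ∪ L.toFinset)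
    have g := Finset.card_union_le (tripFam x₃ z₃ n₃) L.toFinset
    omega
  · intro p hp
    simp only [Finset.mem_union, List.mem_toFinset] at hp
    rcases hp with hp | hp | hp | hp
    · exact fpos _ _ _ h₁ p hp
    · exact fpos _ _ _ h₂ p hp
    · exact fpos _ _ _ h₃ p hp
    · exact hL p hp
  · intro v hv
    rcases hc v hv with h | h | h | ⟨p, hp, h⟩
    · obtain ⟨p, hp, h⟩ := tripHit_mem h
      exact ⟨p, by simp [hp], h⟩
    · obtain ⟨p, hp, h⟩ := tripHit_mem h
      exact ⟨p, by simp [hp], h⟩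
    · obtain ⟨p, hp, h⟩ := tripHit_mem h
      exact ⟨p, by simp [hp], h⟩
    · exact ⟨p, by simp [hp], h⟩

lemma card_perfect (m : ℕ) : (Finset.Icc 3 (3 * m + 2)).card = 3 * m := by
  simp

lemma card_hooked (m : ℕ) (hm : 1 ≤ m) :
    (insert (3 * m + 3) (Finset.Icc 3 (3 * m + 1))).card = 3 * m := by
  rw [Finset.card_insert_of_notMem (by simp)]
  simp
  omega

/-- Lemma on triples: for every m ≥ 5 there is a set T of m triples (0, x, z) whose
difference sets {x, z-x, z} partition {3, ..., 3m+2} (resp. {3, ..., 3m+1} ∪ {3m+3}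
when m ≡ 2, 3 (mod 4)). -/
theorem triples_exist (m : ℕ) (hm : 5 ≤ m) :
    ∃ T : Finset (ℕ × ℕ), T.card = m ∧ (∀ p ∈ T, 0 < p.1 ∧ p.1 < p.2) ∧
      T.biUnion (fun p => ({p.1, p.2 - p.1, p.2} : Finset ℕ)) =
        (if m % 4 = 0 ∨ m % 4 = 1 then Finset.Icc 3 (3 * m + 2)
          else insert (3 * m + 3) (Finset.Icc 3 (3 * m + 1))) ∧
      (T.biUnion (fun p => ({p.1, p.2 - p.1, p.2} : Finset ℕ))).card = 3 * m := by
  obtain ⟨s, hs⟩ : ∃ s, m = 4 * s ∨ m = 4 * s + 1 ∨ m = 4 * s + 2 ∨ m = 4 * s + 3 :=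
    ⟨m / 4, by omega⟩
  rcases hs with rfl | rfl | rfl | rfl
  · rw [if_pos (by omega)]
    by_cases h2 : s = 2
    · subst h2
      exact ⟨{(3, 22), (4, 24), (5, 18), (6, 15), (7, 21), (8, 25), (10, 26), (11, 23)}, by decide, by decide, by decide, by decide⟩
    refine trip_families _ _ (card_perfect _) 4 (10 * s + 2) (2 * s - 1) (2 * s + 5) (7 * s + 3)
      (s - 3) 3 (6 * s + 2) (s - 1)
      [(4 * s + 1, 10 * s + 1), (4 * s - 1, 10 * s), (2 * s + 1, 7 * s + 1),
        (5 * s - 1, 12 * s + 1), (2 * s + 3, 12 * s + 2)]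
      (by simp; omega) (by omega) (by omega) (by omega) (by simp; omega) ?_
    intro v hv
    rw [Finset.mem_Icc] at hv
    simp only [tripHit, tripIn, List.mem_cons, List.not_mem_nil, or_false, exists_eq_or_imp,
      exists_eq_left]
    omega
  · rw [if_pos (by omega)]
    refine trip_families _ _ (card_perfect _) 4 (10 * s + 6) (2 * s - 1) (2 * s + 3) (7 * s + 4)
      (s - 1) 3 (6 * s + 4) (s - 1)
      [(4 * s + 1, 10 * s + 3), (4 * s + 2, 10 * s + 5), (2 * s + 1, 10 * s + 4),
        (5 * s + 2, 12 * s + 5)]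
      (by simp; omega) (by omega) (by omega) (by omega) (by simp; omega) ?_
    intro v hv
    rw [Finset.mem_Icc] at hv
    simp only [tripHit, tripIn, List.mem_cons, List.not_mem_nil, or_false, exists_eq_or_imp,
      exists_eq_left]
    omega
  · rw [if_neg (by omega)]
    by_cases h1 : s = 1
    · subst h1
      exact ⟨{(3, 13), (4, 18), (5, 16), (6, 21), (7, 19), (8, 17)}, by decide, by decide, by decide, by decide⟩
    by_cases h2 : s = 2
    · subst h2
      exact ⟨{(3, 29), (4, 15), (5, 25), (6, 23), (7, 31), (8, 27), (9, 22), (10, 28), (12, 33), (14, 30)}, by decide, by decide, by decide, by decide⟩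
    refine trip_families _ _ (card_hooked _ (by omega)) 4 (10 * s + 7) (2 * s) (2 * s + 7)
      (7 * s + 7) (s - 3) 3 (6 * s + 5) (s + 1)
      [(4 * s + 3, 10 * s + 6), (4 * s + 1, 10 * s + 5), (5 * s + 1, 12 * s + 7),
        (2 * s + 5, 12 * s + 9)]
      (by simp; omega) (by omega) (by omega) (by omega) (by simp; omega) ?_
    intro v hv
    rw [Finset.mem_insert, Finset.mem_Icc] at hv
    simp only [tripHit, tripIn, List.mem_cons, List.not_mem_nil, or_false, exists_eq_or_imp,
      exists_eq_left]
    omega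
  · rw [if_neg (by omega)]
    by_cases h1 : s = 1
    · subst h1
      exact ⟨{(3, 17), (4, 20), (5, 24), (6, 18), (7, 15), (9, 22), (10, 21)}, by decide, by decide, by decide, by decide⟩
    refine trip_families _ _ (card_hooked _ (by omega)) 4 (10 * s + 11) (2 * s) (2 * s + 5)
      (7 * s + 7) (s - 1) 3 (6 * s + 8) (s - 2)
      [(2 * s - 1, 8 * s + 6), (5 * s + 3, 10 * s + 10), (2 * s + 1, 10 * s + 8),
        (5 * s + 4, 10 * s + 9), (2 * s + 3, 6 * s + 6), (5 * s + 6, 12 * s + 12)]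
      (by simp; omega) (by omega) (by omega) (by omega) (by simp; omega) ?_
    intro v hv
    rw [Finset.mem_insert, Finset.mem_Icc] at hv
    simp only [tripHit, tripIn, List.mem_cons, List.not_mem_nil, or_false, exists_eq_or_imp,
      exists_eq_left]
    omega
end

section
/- For every integer m ≥ 5 there exists a partition of the set M into m pairwise disjoint ordered pairs (a_i, b_i), i = 1, ..., m, such that the multiset of differences {b_i − a_i : 1 ≤ i ≤ m} equals {3, 4, ..., m + 2}, where M = {1, 2, ..., 2m} if m ≡ 0 or 1 (mod 4), and M = {1, 2, ..., 2m − 1} ∪ {2m + 1} if m ≡ 2 or 3 (mod 4). -/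
/-- The pair `(v, v + d)` lies in `M`. -/
def Fits (M : Finset ℕ) (d v : ℕ) : Prop := v ∈ M ∧ v + d ∈ M

/-- The pair `(a d, a d + d)` contains `x`, and `d` is an admissible difference. -/
def Covers (m : ℕ) (a : ℕ → ℕ) (x d : ℕ) : Prop :=
  d ∈ Finset.Icc 3 (m + 2) ∧ (a d = x ∨ a d + d = x)

theorem ite_ind {P : ℕ → Prop} {c : Prop} [Decidable c] {x y : ℕ} (hx : c → P x) (hy : ¬ c → P y) :
    P (if c then x else y) := by
  by_cases h : c
  · rw [if_pos h]; exact hx h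
  · rw [if_neg h]; exact hy h

/-- Reduction: it suffices to give, for each difference `d`, the left end `a d`, and to check that
the pairs `(a d, a d + d)` stay inside `M` and cover `M`. -/
theorem pairs_of_fun (m : ℕ) (M : Finset ℕ) (a : ℕ → ℕ)
    (h1 : ∀ d ∈ Finset.Icc 3 (m + 2), a d ∈ M ∧ a d + d ∈ M)
    (h2 : ∀ x ∈ M, ∃ d ∈ Finset.Icc 3 (m + 2), a d = x ∨ a d + d = x) :
    ∃ f : Fin m → ℕ × ℕ,
      (∀ i, (f i).1 < (f i).2) ∧
      (Finset.univ.image (fun i => (f i).2 - (f i).1) = Finset.Icc 3 (m + 2)) ∧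
      (Finset.univ.biUnion (fun i => ({(f i).1, (f i).2} : Finset ℕ)) = M) := by
  refine ⟨fun i => (a (i.1 + 3), a (i.1 + 3) + (i.1 + 3)), fun i => by simp, ?_, ?_⟩
  · ext d
    simp only [Finset.mem_image, Finset.mem_univ, true_and, Finset.mem_Icc]
    constructor
    · rintro ⟨i, rfl⟩
      have := i.2
      omega
    · rintro ⟨h3, h4⟩
      exact ⟨⟨d - 3, by omega⟩, by simp only; omega⟩
  · ext x
    simp only [Finset.mem_biUnion, Finset.mem_univ, true_and, Finset.mem_insert,
      Finset.mem_singleton]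
    constructor
    · rintro ⟨i, hi⟩
      have := i.2
      obtain ⟨p, q⟩ := h1 (i.1 + 3) (Finset.mem_Icc.2 (by omega))
      rcases hi with rfl | rfl
      · exact p
      · exact q
    · intro hx
      obtain ⟨d, hd, h⟩ := h2 x hx
      rw [Finset.mem_Icc] at hd
      refine ⟨⟨d - 3, by omega⟩, ?_⟩
      have e : d - 3 + 3 = d := by omega
      simp only [e]
      rcases h with h | h
      · exact Or.inl h.symm
      · exact Or.inr h.symm

/-- Left ends of the pairs for `m = 4 t + 0`. -/
def left0 (t d : ℕ) : ℕ :=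
  if d = 5 then 6 * t - 1 else
  if d = 4 then 2 * t - 2 else
  if d = 3 then 6 * t else
  if d = 2 * t + 3 then 5 * t - 1 else
  if d = 4 * t then t else
  if d = 2 * t then 2 * t else
  if d = 2 * t + 1 then 3 * t else
  if d = 4 * t + 1 then 2 * t + 1 else
  if d = 4 * t + 2 then 2 * t - 1 else
  if d % 2 = 0 then (if 2 * t + 2 ≤ d then (4 * t - d) / 2 else (4 * t - d) / 2)
  else (if 2 * t + 5 ≤ d then (12 * t + 1 - d) / 2 else (12 * t + 3 - d) / 2)

theorem left0_mem (t : ℕ) (ht : 3 ≤ t) : ∀ d ∈ Finset.Icc 3 (4 * t + 2),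
    Fits (Finset.Icc 1 (2 * (4 * t))) d (left0 t d) := by
  intro d hd
  simp only [Finset.mem_Icc] at hd
  unfold left0
  repeat' refine ite_ind (P := Fits _ d) (fun _ => ?_) (fun _ => ?_)
  all_goals
    simp only [Fits,  Finset.mem_Icc]
    omega

/-- The difference of the pair containing `x`, for `m = 4 t + 0`. -/
def diff0 (t x : ℕ) : ℕ :=
  if x ≤ t - 1 then 4 * t - 2 * x else
  if x ≤ t then 4 * t else
  if x ≤ 2 * t - 3 then 4 * t - 2 * x else
  if x ≤ 2 * t - 2 then 4 else
  if x ≤ 2 * t - 1 then 4 * t + 2 else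
  if x ≤ 2 * t then 2 * t else
  if x ≤ 2 * t + 1 then 4 * t + 1 else
  if x ≤ 2 * t + 2 then 4 else
  if x ≤ 3 * t - 1 then 2 * x - (4 * t) else
  if x ≤ 3 * t then 2 * t + 1 else
  if x ≤ 4 * t - 1 then 2 * x - (4 * t) else
  if x ≤ 4 * t then 2 * t else
  if x ≤ 5 * t - 2 then 12 * t + 1 - 2 * x else
  if x ≤ 5 * t - 1 then 2 * t + 3 else
  if x ≤ 5 * t then 4 * t else
  if x ≤ 5 * t + 1 then 2 * t + 1 else
  if x ≤ 6 * t - 2 then 12 * t + 3 - 2 * x else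
  if x ≤ 6 * t - 1 then 5 else
  if x ≤ 6 * t then 3 else
  if x ≤ 6 * t + 1 then 4 * t + 2 else
  if x ≤ 6 * t + 2 then 4 * t + 1 else
  if x ≤ 6 * t + 3 then 3 else
  if x ≤ 6 * t + 4 then 5 else
  if x ≤ 7 * t + 1 then 2 * x - (12 * t + 3) else
  if x ≤ 7 * t + 2 then 2 * t + 3 else
  2 * x - (12 * t + 1)

theorem left0_cover (t : ℕ) (ht : 3 ≤ t) :
    ∀ x ∈ Finset.Icc 1 (2 * (4 * t)),
      ∃ d ∈ Finset.Icc 3 (4 * t + 2), left0 t d = x ∨ left0 t d + d = x := by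
  intro x hx
  simp only [Finset.mem_Icc] at hx
  suffices h : Covers (4 * t) (left0 t) x (diff0 t x) from ⟨_, h⟩
  unfold diff0
  repeat' refine ite_ind (P := Covers _ _ x) (fun _ => ?_) (fun _ => ?_)
  all_goals
    simp only [Covers, Finset.mem_Icc]
    refine ⟨by omega, ?_⟩
    unfold left0
    repeat (first | rw [if_pos (by omega)] | rw [if_neg (by omega)])
    try omega

/-- Left ends of the pairs for `m = 4 t + 1`. -/
def left1 (t d : ℕ) : ℕ :=
  if d = 4 then 2 * t - 2 else
  if d = 3 then 6 * t else
  if d = 4 * t - 2 then 2 else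
  if d = 4 * t + 2 then 2 * t else
  if d = 4 * t + 3 then 3 * t - 1 else
  if d = 2 * t - 2 then 1 else
  if d = 2 * t + 1 then 3 * t else
  if d = 2 * t then t + 1 else
  if d = 4 * t then 2 * t + 1 else
  if d % 2 = 0 then (if 2 * t + 2 ≤ d then (4 * t + 2 - d) / 2 else (4 * t - d) / 2)
  else (if 2 * t + 3 ≤ d then (12 * t + 3 - d) / 2 else (12 * t + 3 - d) / 2)

theorem left1_mem (t : ℕ) (ht : 4 ≤ t) : ∀ d ∈ Finset.Icc 3 (4 * t + 1 + 2),
    Fits (Finset.Icc 1 (2 * (4 * t + 1))) d (left1 t d) := by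
  intro d hd
  simp only [Finset.mem_Icc] at hd
  unfold left1
  repeat' refine ite_ind (P := Fits _ d) (fun _ => ?_) (fun _ => ?_)
  all_goals
    simp only [Fits,  Finset.mem_Icc]
    omega

/-- The difference of the pair containing `x`, for `m = 4 t + 1`. -/
def diff1 (t x : ℕ) : ℕ :=
  if x ≤ 1 then 2 * t - 2 else
  if x ≤ 2 then 4 * t - 2 else
  if x ≤ t then 4 * t + 2 - 2 * x else
  if x ≤ t + 1 then 2 * t else
  if x ≤ 2 * t - 3 then 4 * t - 2 * x else
  if x ≤ 2 * t - 2 then 4 else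
  if x ≤ 2 * t - 1 then 2 * t - 2 else
  if x ≤ 2 * t then 4 * t + 2 else
  if x ≤ 2 * t + 1 then 4 * t else
  if x ≤ 2 * t + 2 then 4 else
  if x ≤ 3 * t - 2 then 2 * x - (4 * t) else
  if x ≤ 3 * t - 1 then 4 * t + 3 else
  if x ≤ 3 * t then 2 * t + 1 else
  if x ≤ 3 * t + 1 then 2 * t else
  if x ≤ 4 * t - 1 then 2 * x - (4 * t + 2) else
  if x ≤ 4 * t then 4 * t - 2 else
  if x ≤ 5 * t then 12 * t + 3 - 2 * x else
  if x ≤ 5 * t + 1 then 2 * t + 1 else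
  if x ≤ 6 * t - 1 then 12 * t + 3 - 2 * x else
  if x ≤ 6 * t then 3 else
  if x ≤ 6 * t + 1 then 4 * t else
  if x ≤ 6 * t + 2 then 4 * t + 2 else
  if x ≤ 6 * t + 3 then 3 else
  if x ≤ 7 * t + 1 then 2 * x - (12 * t + 3) else
  if x ≤ 7 * t + 2 then 4 * t + 3 else
  2 * x - (12 * t + 3)

theorem left1_cover (t : ℕ) (ht : 4 ≤ t) :
    ∀ x ∈ Finset.Icc 1 (2 * (4 * t + 1)),
      ∃ d ∈ Finset.Icc 3 (4 * t + 1 + 2), left1 t d = x ∨ left1 t d + d = x := by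
  intro x hx
  simp only [Finset.mem_Icc] at hx
  suffices h : Covers (4 * t + 1) (left1 t) x (diff1 t x) from ⟨_, h⟩
  unfold diff1
  repeat' refine ite_ind (P := Covers _ _ x) (fun _ => ?_) (fun _ => ?_)
  all_goals
    simp only [Covers, Finset.mem_Icc]
    refine ⟨by omega, ?_⟩
    unfold left1
    repeat (first | rw [if_pos (by omega)] | rw [if_neg (by omega)])
    try omega

/-- Left ends of the pairs for `m = 4 t + 2`. -/
def left2 (t d : ℕ) : ℕ :=
  if d = 4 then 2 * t - 1 else
  if d = 3 then 6 * t + 2 else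
  if d = 4 * t + 1 then 2 * t + 2 else
  if d = 2 * t then 1 else
  if d = 4 * t + 3 then 3 * t + 1 else
  if d = 4 * t + 2 then 4 * t + 3 else
  if d = 2 * t + 1 then 3 * t + 2 else
  if d = 4 * t + 4 then 2 * t else
  if d % 2 = 0 then (if 2 * t + 2 ≤ d then (4 * t + 4 - d) / 2 else (4 * t + 2 - d) / 2)
  else (if 2 * t + 3 ≤ d then (12 * t + 7 - d) / 2 else (12 * t + 7 - d) / 2)

theorem left2_mem (t : ℕ) (ht : 3 ≤ t) : ∀ d ∈ Finset.Icc 3 (4 * t + 2 + 2),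
    Fits (insert (2 * (4 * t + 2) + 1) (Finset.Icc 1 (2 * (4 * t + 2) - 1))) d (left2 t d) := by
  intro d hd
  simp only [Finset.mem_Icc] at hd
  unfold left2
  repeat' refine ite_ind (P := Fits _ d) (fun _ => ?_) (fun _ => ?_)
  all_goals
    simp only [Fits, Finset.mem_insert, Finset.mem_Icc]
    omega

/-- The difference of the pair containing `x`, for `m = 4 t + 2`. -/
def diff2 (t x : ℕ) : ℕ :=
  if x ≤ 1 then 2 * t else
  if x ≤ t + 1 then 4 * t + 4 - 2 * x else
  if x ≤ 2 * t - 2 then 4 * t + 2 - 2 * x else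
  if x ≤ 2 * t - 1 then 4 else
  if x ≤ 2 * t then 4 * t + 4 else
  if x ≤ 2 * t + 1 then 2 * t else
  if x ≤ 2 * t + 2 then 4 * t + 1 else
  if x ≤ 2 * t + 3 then 4 else
  if x ≤ 3 * t then 2 * x - (4 * t + 2) else
  if x ≤ 3 * t + 1 then 4 * t + 3 else
  if x ≤ 3 * t + 2 then 2 * t + 1 else
  if x ≤ 4 * t + 2 then 2 * x - (4 * t + 4) else
  if x ≤ 4 * t + 3 then 4 * t + 2 else
  if x ≤ 5 * t + 2 then 12 * t + 7 - 2 * x else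
  if x ≤ 5 * t + 3 then 2 * t + 1 else
  if x ≤ 6 * t + 1 then 12 * t + 7 - 2 * x else
  if x ≤ 6 * t + 2 then 3 else
  if x ≤ 6 * t + 3 then 4 * t + 1 else
  if x ≤ 6 * t + 4 then 4 * t + 4 else
  if x ≤ 6 * t + 5 then 3 else
  if x ≤ 7 * t + 3 then 2 * x - (12 * t + 7) else
  if x ≤ 7 * t + 4 then 4 * t + 3 else
  if x ≤ 8 * t + 3 then 2 * x - (12 * t + 7) else
  4 * t + 2

theorem left2_cover (t : ℕ) (ht : 3 ≤ t) :
    ∀ x ∈ insert (2 * (4 * t + 2) + 1) (Finset.Icc 1 (2 * (4 * t + 2) - 1)),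
      ∃ d ∈ Finset.Icc 3 (4 * t + 2 + 2), left2 t d = x ∨ left2 t d + d = x := by
  intro x hx
  simp only [Finset.mem_insert, Finset.mem_Icc] at hx
  suffices h : Covers (4 * t + 2) (left2 t) x (diff2 t x) from ⟨_, h⟩
  unfold diff2
  repeat' refine ite_ind (P := Covers _ _ x) (fun _ => ?_) (fun _ => ?_)
  all_goals
    simp only [Covers, Finset.mem_Icc]
    refine ⟨by omega, ?_⟩
    unfold left2
    repeat (first | rw [if_pos (by omega)] | rw [if_neg (by omega)])
    try omega

/-- Left ends of the pairs for `m = 4 t + 3`. -/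
def left3 (t d : ℕ) : ℕ :=
  if d = 4 * t then 4 * t + 5 else
  if d = 2 * t - 1 then t + 2 else
  if d = 4 * t + 5 then 2 * t + 1 else
  if d = 4 * t + 4 then 3 * t + 2 else
  if d = 4 * t + 2 then 2 * t + 2 else
  if d = 2 * t + 3 then t + 1 else
  if d = 2 * t + 2 then 6 * t + 5 else
  if d = 2 * t + 1 then 3 * t + 3 else
  if d = 4 * t + 3 then 1 else
  if d % 2 = 1 then (if 2 * t + 5 ≤ d then (4 * t + 5 - d) / 2 else (4 * t + 3 - d) / 2)
  else (if 2 * t + 4 ≤ d then (12 * t + 10 - d) / 2 else (12 * t + 10 - d) / 2)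

theorem left3_mem (t : ℕ) (ht : 2 ≤ t) : ∀ d ∈ Finset.Icc 3 (4 * t + 3 + 2),
    Fits (insert (2 * (4 * t + 3) + 1) (Finset.Icc 1 (2 * (4 * t + 3) - 1))) d (left3 t d) := by
  intro d hd
  simp only [Finset.mem_Icc] at hd
  unfold left3
  repeat' refine ite_ind (P := Fits _ d) (fun _ => ?_) (fun _ => ?_)
  all_goals
    simp only [Fits, Finset.mem_insert, Finset.mem_Icc]
    omega

/-- The difference of the pair containing `x`, for `m = 4 t + 3`. -/
def diff3 (t x : ℕ) : ℕ :=
  if x ≤ 1 then 4 * t + 3 else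
  if x ≤ t then 4 * t + 5 - 2 * x else
  if x ≤ t + 1 then 2 * t + 3 else
  if x ≤ t + 2 then 2 * t - 1 else
  if x ≤ 2 * t then 4 * t + 3 - 2 * x else
  if x ≤ 2 * t + 1 then 4 * t + 5 else
  if x ≤ 2 * t + 2 then 4 * t + 2 else
  if x ≤ 3 * t then 2 * x - (4 * t + 3) else
  if x ≤ 3 * t + 1 then 2 * t - 1 else
  if x ≤ 3 * t + 2 then 4 * t + 4 else
  if x ≤ 3 * t + 3 then 2 * t + 1 else
  if x ≤ 3 * t + 4 then 2 * t + 3 else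
  if x ≤ 4 * t + 3 then 2 * x - (4 * t + 5) else
  if x ≤ 4 * t + 4 then 4 * t + 3 else
  if x ≤ 4 * t + 5 then 4 * t else
  if x ≤ 5 * t + 3 then 12 * t + 10 - 2 * x else
  if x ≤ 5 * t + 4 then 2 * t + 1 else
  if x ≤ 6 * t + 3 then 12 * t + 10 - 2 * x else
  if x ≤ 6 * t + 4 then 4 * t + 2 else
  if x ≤ 6 * t + 5 then 2 * t + 2 else
  if x ≤ 6 * t + 6 then 4 * t + 5 else
  if x ≤ 7 * t + 5 then 2 * x - (12 * t + 10) else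
  if x ≤ 7 * t + 6 then 4 * t + 4 else
  if x ≤ 8 * t + 4 then 2 * x - (12 * t + 10) else
  if x ≤ 8 * t + 5 then 4 * t else
  2 * t + 2

theorem left3_cover (t : ℕ) (ht : 2 ≤ t) :
    ∀ x ∈ insert (2 * (4 * t + 3) + 1) (Finset.Icc 1 (2 * (4 * t + 3) - 1)),
      ∃ d ∈ Finset.Icc 3 (4 * t + 3 + 2), left3 t d = x ∨ left3 t d + d = x := by
  intro x hx
  simp only [Finset.mem_insert, Finset.mem_Icc] at hx
  suffices h : Covers (4 * t + 3) (left3 t) x (diff3 t x) from ⟨_, h⟩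
  unfold diff3
  repeat' refine ite_ind (P := Covers _ _ x) (fun _ => ?_) (fun _ => ?_)
  all_goals
    simp only [Covers, Finset.mem_Icc]
    refine ⟨by omega, ?_⟩
    unfold left3
    repeat (first | rw [if_pos (by omega)] | rw [if_neg (by omega)])
    try omega

/-- For every m ≥ 5 the set M can be partitioned into m ordered pairs whose set of
differences is exactly {3, 4, ..., m+2}, where M = {1, ..., 2m} if m ≡ 0, 1 (mod 4)
and M = {1, ..., 2m-1} ∪ {2m+1} if m ≡ 2, 3 (mod 4). -/
theorem graceful_pairs_exist (m : ℕ) (hm : 5 ≤ m) :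
    ∃ f : Fin m → ℕ × ℕ,
      (∀ i, (f i).1 < (f i).2) ∧
      (Finset.univ.image (fun i => (f i).2 - (f i).1) = Finset.Icc 3 (m + 2)) ∧
      (Finset.univ.biUnion (fun i => ({(f i).1, (f i).2} : Finset ℕ)) =
        if m % 4 = 0 ∨ m % 4 = 1 then Finset.Icc 1 (2 * m)
        else insert (2 * m + 1) (Finset.Icc 1 (2 * m - 1))) := by
  have key : m = 5 ∨ m = 6 ∨ m = 7 ∨ m = 8 ∨ m = 9 ∨ m = 10 ∨ m = 13 ∨
      (∃ t, 3 ≤ t ∧ m = 4 * t) ∨ (∃ t, 4 ≤ t ∧ m = 4 * t + 1) ∨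
      (∃ t, 3 ≤ t ∧ m = 4 * t + 2) ∨ (∃ t, 2 ≤ t ∧ m = 4 * t + 3) := by
    have h4 : m % 4 = 0 ∨ m % 4 = 1 ∨ m % 4 = 2 ∨ m % 4 = 3 := by omega
    by_cases hs : m ≤ 10 ∨ m = 13
    · omega
    · have e : m = 4 * (m / 4) + m % 4 := by omega
      have hq : 2 ≤ m / 4 := by omega
      generalize m / 4 = q at e hq
      iterate 7 apply Or.inr
      rcases h4 with h | h | h | h
      · exact Or.inl ⟨q, by omega, by omega⟩
      · exact Or.inr (Or.inl ⟨q, by omega, by omega⟩)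
      · exact Or.inr (Or.inr (Or.inl ⟨q, by omega, by omega⟩))
      · exact Or.inr (Or.inr (Or.inr ⟨q, by omega, by omega⟩))
  rcases key with rfl | rfl | rfl | rfl | rfl | rfl | rfl | ⟨t, ht, rfl⟩ | ⟨t, ht, rfl⟩ | ⟨t, ht, rfl⟩ | ⟨t, ht, rfl⟩
  · exact pairs_of_fun 5 _ (fun d => List.getD [4, 2, 5, 3, 1] (d - 3) 0) (by decide) (by decide)
  · exact pairs_of_fun 6 _ (fun d => List.getD [4, 2, 8, 5, 3, 1] (d - 3) 0) (by decide) (by decide)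
  · exact pairs_of_fun 7 _ (fun d => List.getD [4, 2, 8, 9, 5, 3, 1] (d - 3) 0) (by decide) (by decide)
  · exact pairs_of_fun 8 _ (fun d => List.getD [4, 2, 9, 10, 8, 5, 3, 1] (d - 3) 0) (by decide) (by decide)
  · exact pairs_of_fun 9 _ (fun d => List.getD [4, 14, 5, 11, 2, 8, 6, 3, 1] (d - 3) 0) (by decide) (by decide)
  · exact pairs_of_fun 10 _ (fun d => List.getD [4, 6, 16, 12, 2, 11, 8, 5, 3, 1] (d - 3) 0) (by decide) (by decide)
  · exact pairs_of_fun 13 _ (fun d => List.getD [22, 8, 21, 4, 6, 15, 2, 14, 9, 7, 5, 3, 1] (d - 3) 0) (by decide) (by decide)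
  · rw [if_pos (by omega)]
    exact pairs_of_fun _ _ (left0 t) (left0_mem t ht) (left0_cover t ht)
  · rw [if_pos (by omega)]
    exact pairs_of_fun _ _ (left1 t) (left1_mem t ht) (left1_cover t ht)
  · rw [if_neg (by omega)]
    exact pairs_of_fun _ _ (left2 t) (left2_mem t ht) (left2_cover t ht)
  · rw [if_neg (by omega)]
    exact pairs_of_fun _ _ (left3 t) (left3_mem t ht) (left3_cover t ht)
end
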